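/- As e → ∞, S(e) is asymptotic to (4/(3π)) · ln(e); that is, the limit of S(e) / ln(e) as e → ∞ equals 4/(3π). -/

import Mathlib

open MeasureTheory Real Filter

/-- `S(e) = (4/(3π)) ∫₀^∞ e k⁵/((k² + k)(e + k² + k)) · (1/k⁴ + 1/(k² + k)²) dk`, the
cut-off-free, mass-renormalized energy level shift in the Pauli–Fierz model. -/
noncomputable def bindingS (e : ℝ) : ℝ :=
  (4 / (3 * π)) * ∫ k in Set.Ioi (0 : ℝ),
    e * k ^ 5 / ((k ^ 2 + k) * (e + k ^ 2 + k)) * (1 / k ^ 4 + 1 / (k ^ 2 + k) ^ 2)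

theorem hasDerivAt_neg_log_one_add_div_sq {c k : ℝ} (hc : 0 < c) (hk : 0 ≤ k) :
    HasDerivAt (fun x : ℝ => -(1 / (2 * c)) * Real.log (1 + c / (x + 1) ^ 2))
      (1 / ((k + 1) * (c + (k + 1) ^ 2))) k := by
  have hu : 0 < k + 1 := by linarith
  have h1 : HasDerivAt (fun x : ℝ => (x + 1) ^ 2) (2 * (k + 1)) k := by
    simpa using ((hasDerivAt_id' k).add_const 1).fun_pow 2
  have h2 := (((hasDerivAt_const k c).div h1 (by positivity)).const_add 1).log
    (by simp only [Pi.div_apply]; positivity)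
  refine (h2.const_mul (-(1 / (2 * c)))).congr_deriv ?_
  simp only [Pi.div_apply]
  have : 0 < c + (k + 1) ^ 2 := by positivity
  have : 0 < (k + 1) ^ 2 + c := by positivity
  field_simp
  ring

theorem tendsto_neg_log_one_add_div_sq (c : ℝ) :
    Tendsto (fun x : ℝ => -(1 / (2 * c)) * Real.log (1 + c / (x + 1) ^ 2)) atTop (nhds 0) := by
  have h1 : Tendsto (fun x : ℝ => (x + 1) ^ 2) atTop atTop :=
    (tendsto_pow_atTop two_ne_zero).comp (tendsto_atTop_add_const_right _ _ tendsto_id)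
  have h2 : Tendsto (fun x : ℝ => 1 + c / (x + 1) ^ 2) atTop (nhds 1) := by
    simpa using (h1.const_div_atTop c).const_add 1
  simpa using (h2.log one_ne_zero).const_mul (-(1 / (2 * c)))

theorem integrableOn_one_div_mul_add_sq {c : ℝ} (hc : 0 < c) :
    IntegrableOn (fun k : ℝ => 1 / ((k + 1) * (c + (k + 1) ^ 2))) (Set.Ioi 0) :=
  integrableOn_Ioi_deriv_of_nonneg'
    (fun _ hx => hasDerivAt_neg_log_one_add_div_sq hc hx)
    (fun x hx => by have : 0 < x := hx; positivity) (tendsto_neg_log_one_add_div_sq c)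

theorem integral_one_div_mul_add_sq {c : ℝ} (hc : 0 < c) :
    ∫ k in Set.Ioi (0 : ℝ), 1 / ((k + 1) * (c + (k + 1) ^ 2)) = Real.log (1 + c) / (2 * c) := by
  rw [integral_Ioi_of_hasDerivAt_of_nonneg'
    (fun _ hx => hasDerivAt_neg_log_one_add_div_sq hc hx)
    (fun x hx => by have : 0 < x := hx; positivity) (tendsto_neg_log_one_add_div_sq c)]
  norm_num
  ring

theorem hasDerivAt_neg_one_div_add_one {k : ℝ} (hk : 0 ≤ k) :
    HasDerivAt (fun x : ℝ => -(x + 1)⁻¹) (1 / (k + 1) ^ 2) k := by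
  have hu : k + 1 ≠ 0 := by linarith
  refine (((hasDerivAt_id k).add_const 1).inv hu).neg.congr_deriv ?_
  simp [neg_div]

theorem tendsto_neg_one_div_add_one :
    Tendsto (fun x : ℝ => -(x + 1)⁻¹) atTop (nhds 0) := by
  simpa using (tendsto_inv_atTop_zero.comp
    (tendsto_atTop_add_const_right atTop (1 : ℝ) tendsto_id)).neg

theorem integrableOn_one_div_add_one_sq :
    IntegrableOn (fun k : ℝ => 1 / (k + 1) ^ 2) (Set.Ioi 0) :=
  integrableOn_Ioi_deriv_of_nonneg' (fun _ hx => hasDerivAt_neg_one_div_add_one hx)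
    (fun x _ => by positivity) tendsto_neg_one_div_add_one

theorem integral_one_div_add_one_sq :
    ∫ k in Set.Ioi (0 : ℝ), 1 / (k + 1) ^ 2 = 1 := by
  rw [integral_Ioi_of_hasDerivAt_of_nonneg' (fun _ hx => hasDerivAt_neg_one_div_add_one hx)
    (fun x _ => by positivity) tendsto_neg_one_div_add_one]
  norm_num

/-- The integrand of `bindingS`. -/
noncomputable def bindingIntegrand (e k : ℝ) : ℝ :=
  e * k ^ 5 / ((k ^ 2 + k) * (e + k ^ 2 + k)) * (1 / k ^ 4 + 1 / (k ^ 2 + k) ^ 2)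

theorem bindingIntegrand_eq {e k : ℝ} (he : 0 < e) (hk : 0 < k) :
    bindingIntegrand e k =
      e / ((k + 1) * (e + k ^ 2 + k)) * (1 + k ^ 2 / (k + 1) ^ 2) := by
  have : 0 < e + k ^ 2 + k := by positivity
  have h : k ^ 2 + k = k * (k + 1) := by ring
  rw [bindingIntegrand, h]
  field_simp

theorem bindingIntegrand_nonneg {e k : ℝ} (he : 0 < e) (hk : 0 < k) :
    0 ≤ bindingIntegrand e k := by
  rw [bindingIntegrand_eq he hk]
  positivity

theorem bindingIntegrand_le {e k : ℝ} (he : 1 ≤ e) (hk : 0 < k) :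
    bindingIntegrand e k ≤ 4 * e * (1 / ((k + 1) * (2 * e - 1 + (k + 1) ^ 2))) := by
  have he0 : 0 < e := by linarith
  have hc : 0 < 2 * e - 1 := by linarith
  rw [bindingIntegrand_eq he0 hk]
  have h1 : 1 + k ^ 2 / (k + 1) ^ 2 ≤ 2 := by
    have : k ^ 2 / (k + 1) ^ 2 ≤ 1 := by
      rw [div_le_one (by positivity)]
      nlinarith
    linarith
  calc e / ((k + 1) * (e + k ^ 2 + k)) * (1 + k ^ 2 / (k + 1) ^ 2)
      ≤ e / ((k + 1) * (e + k ^ 2 + k)) * 2 := by gcongr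
    _ ≤ e / ((k + 1) * ((2 * e - 1 + (k + 1) ^ 2) / 2)) * 2 := by
        gcongr
        nlinarith
    _ = 4 * e * (1 / ((k + 1) * (2 * e - 1 + (k + 1) ^ 2))) := by
        have : 0 < 2 * e - 1 + (k + 1) ^ 2 := by positivity
        field_simp
        ring

theorem le_bindingIntegrand {e k : ℝ} (he : 0 < e) (hk : 0 < k) :
    2 * e * (1 / ((k + 1) * (e + (k + 1) ^ 2))) - 2 * (1 / (k + 1) ^ 2) ≤
      bindingIntegrand e k := by
  rw [bindingIntegrand_eq he hk]
  have h1 : 2 - 2 / (k + 1) ≤ 1 + k ^ 2 / (k + 1) ^ 2 := by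
    rw [← sub_nonneg]
    have : 1 + k ^ 2 / (k + 1) ^ 2 - (2 - 2 / (k + 1)) = 1 / (k + 1) ^ 2 := by
      field_simp
      ring
    rw [this]
    positivity
  have h2 : e / (e + (k + 1) ^ 2) ≤ 1 := by
    rw [div_le_one (by positivity)]
    nlinarith
  calc 2 * e * (1 / ((k + 1) * (e + (k + 1) ^ 2))) - 2 * (1 / (k + 1) ^ 2)
      ≤ 2 * e * (1 / ((k + 1) * (e + (k + 1) ^ 2)))
          - 2 * (1 / (k + 1) ^ 2) * (e / (e + (k + 1) ^ 2)) := by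
        exact sub_le_sub_left (mul_le_of_le_one_right (by positivity) h2) _
    _ = e / ((k + 1) * (e + (k + 1) ^ 2)) * (2 - 2 / (k + 1)) := by
        field_simp
    _ ≤ e / ((k + 1) * (e + (k + 1) ^ 2)) * (1 + k ^ 2 / (k + 1) ^ 2) := by gcongr
    _ ≤ e / ((k + 1) * (e + k ^ 2 + k)) * (1 + k ^ 2 / (k + 1) ^ 2) := by
        gcongr ?_ * _
        gcongr e / (_ * ?_)
        nlinarith

theorem integrableOn_bindingIntegrand {e : ℝ} (he : 1 ≤ e) :
    IntegrableOn (bindingIntegrand e) (Set.Ioi 0) := by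
  refine ((integrableOn_one_div_mul_add_sq (c := 2 * e - 1) (by linarith)).const_mul
    (4 * e)).mono' ?_ ?_
  · unfold bindingIntegrand
    fun_prop
  · filter_upwards [ae_restrict_mem measurableSet_Ioi] with k hk
    rw [Real.norm_of_nonneg (bindingIntegrand_nonneg (by linarith) hk)]
    exact bindingIntegrand_le he hk

theorem integral_bindingIntegrand_le {e : ℝ} (he : 1 ≤ e) :
    ∫ k in Set.Ioi (0 : ℝ), bindingIntegrand e k ≤
      2 * e / (2 * e - 1) * Real.log (2 * e) := by
  have hc : 0 < 2 * e - 1 := by linarith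
  calc ∫ k in Set.Ioi (0 : ℝ), bindingIntegrand e k
      ≤ ∫ k in Set.Ioi (0 : ℝ), 4 * e * (1 / ((k + 1) * (2 * e - 1 + (k + 1) ^ 2))) :=
        setIntegral_mono_on (integrableOn_bindingIntegrand he)
          ((integrableOn_one_div_mul_add_sq hc).const_mul _) measurableSet_Ioi
          fun _ hk => bindingIntegrand_le he hk
    _ = 2 * e / (2 * e - 1) * Real.log (2 * e) := by
        rw [integral_const_mul, integral_one_div_mul_add_sq hc, add_sub_cancel]
        field_simp
        ring

theorem le_integral_bindingIntegrand {e : ℝ} (he : 1 ≤ e) :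
    Real.log e - 2 ≤ ∫ k in Set.Ioi (0 : ℝ), bindingIntegrand e k := by
  have he0 : 0 < e := by linarith
  have hi₁ := (integrableOn_one_div_mul_add_sq he0).const_mul (2 * e)
  have hi₂ := integrableOn_one_div_add_one_sq.const_mul 2
  calc Real.log e - 2 ≤ Real.log (1 + e) - 2 := by
        gcongr
        linarith
    _ = ∫ k in Set.Ioi (0 : ℝ),
          (2 * e * (1 / ((k + 1) * (e + (k + 1) ^ 2))) - 2 * (1 / (k + 1) ^ 2)) := by
        rw [integral_sub hi₁ hi₂, integral_const_mul, integral_const_mul,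
          integral_one_div_mul_add_sq he0, integral_one_div_add_one_sq]
        field_simp
    _ ≤ ∫ k in Set.Ioi (0 : ℝ), bindingIntegrand e k :=
        setIntegral_mono_on (hi₁.sub hi₂) (integrableOn_bindingIntegrand he) measurableSet_Ioi
          fun _ hk => le_bindingIntegrand he0 hk

theorem tendsto_integral_bindingIntegrand_div_log :
    Tendsto (fun e => (∫ k in Set.Ioi (0 : ℝ), bindingIntegrand e k) / Real.log e)
      atTop (nhds 1) := by
  have hlow : Tendsto (fun e : ℝ => 1 - 2 / Real.log e) atTop (nhds 1) := by
    simpa using (Real.tendsto_log_atTop.const_div_atTop 2).const_sub 1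
  have hlin : Tendsto (fun e : ℝ => 2 * e - 1) atTop atTop :=
    tendsto_atTop_add_const_right _ (-1) (tendsto_id.const_mul_atTop two_pos)
  have hup : Tendsto (fun e : ℝ => (1 + 1 / (2 * e - 1)) * (1 + Real.log 2 / Real.log e))
      atTop (nhds 1) := by
    simpa using ((hlin.const_div_atTop 1).const_add 1).mul
      ((Real.tendsto_log_atTop.const_div_atTop (Real.log 2)).const_add 1)
  refine tendsto_of_tendsto_of_tendsto_of_le_of_le' hlow hup ?_ ?_
  · filter_upwards [eventually_gt_atTop 1] with e he
    have hl := Real.log_pos he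
    rw [le_div_iff₀ hl, sub_mul, one_mul, div_mul_cancel₀ _ hl.ne']
    exact le_integral_bindingIntegrand he.le
  · filter_upwards [eventually_gt_atTop 1] with e he
    have hl := Real.log_pos he
    have hc : 0 < 2 * e - 1 := by linarith
    rw [div_le_iff₀ hl]
    refine (integral_bindingIntegrand_le he.le).trans_eq ?_
    rw [Real.log_mul two_ne_zero (by linarith)]
    field_simp
    ring

/-- As `e → ∞`, `S(e)` is asymptotic to `(4/(3π)) ln e`. -/
theorem bindingS_asymptotics_infty :
    Tendsto (fun e => bindingS e / Real.log e) atTop (nhds (4 / (3 * π))) := by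
  simpa [bindingS, bindingIntegrand, mul_div_assoc] using
    tendsto_integral_bindingIntegrand_div_log.const_mul (4 / (3 * π))
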